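/- Let K be an algebraically closed field of characteristic zero, R = K[y,z] the ring of binary forms, d a nonnegative integer, r ∈ {0, …, d}, and let F ∈ R_d be a linear combination of r d-th powers of linear forms in y and z. Then F belongs to z^r·R_{d−r} (i.e., F is divisible by z^r) if and only if F is a scalar multiple of z^d. -/

import Mathlib

open MvPolynomial

/-- If the first `r` power sums of `r` points, with weights, vanish, then all of them do. -/
theorem sum_mul_pow_eq_zero_of_forall_lt {K : Type*} [Field K] {r : ℕ} (w t : Fin r → K)
    (h : ∀ j < r, ∑ i, w i * t i ^ j = 0) (n : ℕ) : ∑ i, w i * t i ^ n = 0 := by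
  set P : Polynomial K := ∏ i, (Polynomial.X - Polynomial.C (t i)) with hP
  have hmonic : P.Monic := Polynomial.monic_prod_X_sub_C t Finset.univ
  have hroot (i : Fin r) : P.eval (t i) = 0 := by
    rw [hP, Polynomial.eval_prod]
    exact Finset.prod_eq_zero (Finset.mem_univ i) (by simp)
  set Q := (Polynomial.X ^ n : Polynomial K) %ₘ P with hQ
  have hdeg (i : Fin r) : Q.natDegree < r := by
    have hP1 : P ≠ 1 := fun h1 => by simpa [h1] using hroot i
    have hPdeg : P.natDegree = r := by
      simp [hP, Polynomial.natDegree_prod_of_monic, Polynomial.monic_X_sub_C]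
    exact hPdeg ▸ Polynomial.natDegree_modByMonic_lt _ hmonic hP1
  have heval (i : Fin r) : t i ^ n = ∑ j ∈ Finset.range r, Q.coeff j * t i ^ j := by
    have := congrArg (Polynomial.eval (t i))
      (Polynomial.modByMonic_add_div (Polynomial.X ^ n : Polynomial K) P)
    simp only [Polynomial.eval_add, Polynomial.eval_mul, hroot, zero_mul, add_zero,
      Polynomial.eval_pow, Polynomial.eval_X] at this
    rw [← this, ← hQ, Polynomial.eval_eq_sum_range' (hdeg i)]
  calc ∑ i, w i * t i ^ n
      = ∑ j ∈ Finset.range r, Q.coeff j * ∑ i, w i * t i ^ j := by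
        simp_rw [heval, Finset.mul_sum]
        rw [Finset.sum_comm]
        exact Finset.sum_congr rfl fun j _ => Finset.sum_congr rfl fun i _ => by ring
    _ = 0 := Finset.sum_eq_zero fun j hj => by rw [h j (Finset.mem_range.1 hj), mul_zero]

/-- A binary linear form is `a y + b z`. -/
theorem MvPolynomial.IsHomogeneous.exists_eq_linear_form {K : Type*} [Field K]
    {p : MvPolynomial (Fin 2) K} (hp : p.IsHomogeneous 1) :
    ∃ a b : K, p = C a * X 0 + C b * X 1 := by
  have hmem : p ∈ Submodule.span K (Set.range (X : Fin 2 → MvPolynomial (Fin 2) K)) := by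
    rw [← homogeneousSubmodule_one_eq_span_X]
    exact hp
  obtain ⟨f, rfl⟩ := (Submodule.mem_span_range_iff_exists_fun K).1 hmem
  exact ⟨f 0, f 1, by simp [Fin.sum_univ_two, smul_eq_C_mul]⟩

theorem Polynomial.coeff_one_add_C_mul_X_pow {K : Type*} [CommSemiring K] (t : K) (d j : ℕ) :
    ((1 + Polynomial.C t * Polynomial.X) ^ d).coeff j = d.choose j * t ^ j := by
  have : (1 + Polynomial.C t * Polynomial.X) ^ d
      = ((1 + Polynomial.X) ^ d : Polynomial K).comp (Polynomial.C t * Polynomial.X) := by simp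
  rw [this, Polynomial.comp_C_mul_X_coeff, Polynomial.coeff_one_add_X_pow]

/-- If all power sums of the weighted points `t i` vanish, so does the corresponding sum of powers
of the linear forms `y + t i z`. -/
theorem sum_C_mul_linear_form_pow_eq_zero {K : Type*} [Field K] {r : ℕ} (w t : Fin r → K)
    (h : ∀ n, ∑ i, w i * t i ^ n = 0) (d : ℕ) :
    ∑ i, C (w i) * (X 0 + C (t i) * X 1 : MvPolynomial (Fin 2) K) ^ d = 0 := by
  simp_rw [add_pow, Finset.mul_sum]
  rw [Finset.sum_comm]
  refine Finset.sum_eq_zero fun m _ => ?_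
  calc ∑ i, C (w i) *
        (X 0 ^ m * (C (t i) * X 1) ^ (d - m) * (d.choose m : MvPolynomial (Fin 2) K))
      = C (∑ i, w i * t i ^ (d - m)) *
          (X 0 ^ m * X 1 ^ (d - m) * (d.choose m : MvPolynomial (Fin 2) K)) := by
        rw [map_sum, Finset.sum_mul]
        exact Finset.sum_congr rfl fun i _ => by rw [C_mul, C_pow]; ring
    _ = 0 := by rw [h, C_0, zero_mul]

/-- If `F ∈ K[y,z]` (with `y = X 0`, `z = X 1`) is a linear combination of `r`
`d`-th powers of linear forms, `0 ≤ r ≤ d`, then `F ∈ z^r·K[y,z]_{d-r}` iff `F`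
is a scalar multiple of `z^d`. -/
theorem divisible_iff_scalar_multiple (K : Type*) [Field K] [IsAlgClosed K] [CharZero K]
    (d r : ℕ) (hr : r ≤ d)
    (c : Fin r → K) (ℓ : Fin r → MvPolynomial (Fin 2) K)
    (hhom : ∀ i, (ℓ i).IsHomogeneous 1)
    (F : MvPolynomial (Fin 2) K) (hF : F = ∑ i, c i • ℓ i ^ d) :
    (∃ G : MvPolynomial (Fin 2) K, G.IsHomogeneous (d - r) ∧ F = X 1 ^ r * G) ↔
      ∃ a : K, F = C a * X 1 ^ d := by
  classical
  constructor
  · rintro ⟨G, -, hG⟩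
    choose a b hab using fun i => (hhom i).exists_eq_linear_form
    set w : Fin r → K := fun i => c i * a i ^ d with hw
    set t : Fin r → K := fun i => b i / a i with ht
    set e : Fin r → K := fun i => if a i = 0 then c i * b i ^ d else 0 with he
    have hterm (i : Fin r) : c i • ℓ i ^ d
        = C (w i) * (X 0 + C (t i) * X 1) ^ d + C (e i) * X 1 ^ d := by
      have hd : d ≠ 0 := by have := i.pos; omega
      by_cases hai : a i = 0
      · simp [hab, hw, he, hai, hd, smul_eq_C_mul, mul_pow, mul_assoc]
      · have hb : b i = a i * t i := by simp only [ht]; field_simp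
        simp only [hab, hw, he, hai, if_false, C_0, zero_mul, add_zero, smul_eq_C_mul]
        rw [hb, C_mul, C_mul, C_pow, mul_assoc, ← mul_add, mul_pow, mul_assoc]
    have hFsum : F = ∑ i, C (w i) * (X 0 + C (t i) * X 1) ^ d + C (∑ i, e i) * X 1 ^ d := by
      rw [hF, map_sum, Finset.sum_mul, ← Finset.sum_add_distrib]
      exact Finset.sum_congr rfl fun i _ => hterm i
    have hpow : ∀ j < r, ∑ i, w i * t i ^ j = 0 := by
      intro j hj
      have hdehom := congrArg
        (fun p => (aeval ![1, (Polynomial.X : Polynomial K)] p).coeff j) (hFsum.symm.trans hG)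
      simp [Polynomial.algebraMap_eq, Polynomial.coeff_X_pow_mul', Polynomial.coeff_mul_X_pow',
        hj.not_ge, (hj.trans_le hr).not_ge, Polynomial.coeff_one_add_C_mul_X_pow] at hdehom
      have hchoose : (d.choose j : K) ≠ 0 :=
        Nat.cast_ne_zero.2 (Nat.choose_pos (hj.le.trans hr)).ne'
      refine (mul_eq_zero.1 ?_).resolve_left hchoose
      rw [Finset.mul_sum, ← hdehom]
      exact Finset.sum_congr rfl fun i _ => by ring
    refine ⟨∑ i, e i, ?_⟩
    rw [hFsum, sum_C_mul_linear_form_pow_eq_zero w t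
      (sum_mul_pow_eq_zero_of_forall_lt w t hpow) d, zero_add]
  · rintro ⟨a, rfl⟩
    refine ⟨C a * X 1 ^ (d - r), ?_, ?_⟩
    · simpa using (isHomogeneous_C (Fin 2) a).mul (isHomogeneous_X_pow (R := K) 1 (d - r))
    · rw [mul_left_comm, ← pow_add, Nat.add_sub_cancel' hr]
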